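/- Schauder fixed point theorem: Let A be a nonempty, convex, compact subset of a Banach space X and T : A → A continuous. Then T has a fixed point. -/

import Mathlib

section Scarf
open Finset

variable {S I L : Type*} [Fintype S] [DecidableEq S] [Fintype I] [DecidableEq I] [LinearOrder L]

def SDom (u : I → S → L) (R : Finset S) : Prop := ∀ y, ∃ i, ∀ x ∈ R, u i y ≤ u i x

open Classical in
theorem room_parity (c : S → I) (i0 : I) (R : Finset S) (hR : R.card = Fintype.card I)
    (hc : R.image c ≠ univ) :
    Even (R.filter (fun x => (R.erase x).image c = univ.erase i0)).card := by
  set D := R.filter (fun x => (R.erase x).image c = univ.erase i0) with hD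
  rcases D.eq_empty_or_nonempty with h | ⟨x, hx⟩
  · simp [h]
  have key : ∀ z ∈ D, Set.InjOn c (R.erase z) := by
    intro z hz
    rw [hD, mem_filter] at hz
    rw [← card_image_iff, hz.2, card_erase_of_mem (mem_univ _), card_erase_of_mem hz.1, hR]
    rfl
  have hx' := hx
  rw [hD, mem_filter] at hx'
  obtain ⟨hxR, hxi⟩ := hx'
  have hcx : c x ≠ i0 := by
    intro h
    apply hc
    rw [← insert_erase hxR, image_insert, hxi, h, insert_erase (mem_univ _)]
  have hm : c x ∈ (R.erase x).image c := by rw [hxi]; simp [hcx]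
  obtain ⟨x', hx'R, hcx'⟩ := mem_image.1 hm
  have hne : x' ≠ x := (mem_erase.1 hx'R).1
  have hx'm : x' ∈ R := (mem_erase.1 hx'R).2
  have hDe : D = {x, x'} := by
    ext z
    simp only [mem_insert, mem_singleton]
    constructor
    · intro hz
      by_contra! hcon
      exact hne (key z hz (by simp [hx'm, hcon.2.symm]) (by simp [hxR, hcon.1.symm]) hcx')
    · rintro (rfl | rfl)
      · exact hx
      · rw [hD, mem_filter]
        refine ⟨hx'm, ?_⟩
        rw [← hxi]
        ext j
        simp only [mem_image, mem_erase]
        constructor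
        · rintro ⟨w, ⟨h1, h2⟩, rfl⟩
          by_cases h : w = x
          · exact ⟨z, ⟨hne, hx'm⟩, by rw [hcx', h]⟩
          · exact ⟨w, ⟨h, h2⟩, rfl⟩
        · rintro ⟨w, ⟨h1, h2⟩, rfl⟩
          by_cases h : w = z
          · exact ⟨x, ⟨hne.symm, hxR⟩, by rw [h, hcx']⟩
          · exact ⟨w, ⟨h, h2⟩, rfl⟩
  rw [hDe, card_pair hne.symm]
  exact even_two

open Classical in
theorem door_two (u : I → S → L) (hu : ∀ i, Function.Injective (u i)) (τ : Finset S)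
    (hτ : τ.card + 1 = Fintype.card I) (hne : τ.Nonempty) (hdom : SDom u τ)
    (hM : ∀ a, ∃ y, ∀ i, i ≠ a → ∃ t ∈ τ, u i t < u i y) :
    (univ.filter (fun x => x ∉ τ ∧ SDom u (insert x τ))).card = 2 := by
  have hm0 : ∀ i, ∃ t ∈ τ, ∀ x ∈ τ, u i t ≤ u i x := fun i => exists_min_image τ (u i) hne
  choose m hmτ hmin using hm0
  have hsmall : ∀ i j, i ≠ j → ¬ (τ ⊆ ((univ.erase i).erase j).image m) := by
    intro i j hij h
    have h1 := card_le_card h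
    have h2 := h1.trans card_image_le
    rw [card_erase_of_mem (by simp [hij.symm]), card_erase_of_mem (mem_univ _), card_univ] at h2
    have : 0 < τ.card := hne.card_pos
    omega
  obtain ⟨a, -, b, -, hab, hmab⟩ := exists_ne_map_eq_of_card_lt_of_maps_to
    (s := (univ : Finset I)) (t := τ) (by rw [card_univ]; omega) (f := m) (fun i _ => hmτ i)
  -- claim 1
  have claim1 : ∀ x, x ∉ τ → SDom u (insert x τ) → ∃ j, (j = a ∨ j = b) ∧ u j x < u j (m j) ∧
      ∀ i, i ≠ j → u i (m i) < u i x := by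
    intro x hx hd
    obtain ⟨j, hj⟩ := hd x
    have hlt : ∀ i, u i x ≤ u i (m i) → u i x < u i (m i) := by
      intro i h
      refine lt_of_le_of_ne h fun h' => hx ?_
      rw [hu i h']; exact hmτ i
    have hjm : u j x < u j (m j) := hlt j (hj _ (mem_insert_of_mem (hmτ j)))
    have hrep : ∀ t ∈ τ, ∃ i, m i = t ∧ u i (m i) < u i x := by
      intro t ht
      obtain ⟨i, hi⟩ := hd t
      have h1 : m i = t := hu i (le_antisymm (hmin i t ht) (hi _ (mem_insert_of_mem (hmτ i))))
      refine ⟨i, h1, ?_⟩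
      refine lt_of_le_of_ne (h1 ▸ hi x (mem_insert_self _ _)) fun h' => hx ?_
      rw [← hu i h']; exact hmτ i
    refine ⟨j, ?_, hjm, ?_⟩
    · by_contra! hcon
      apply hsmall j a hcon.1
      intro t ht
      obtain ⟨i, hi, hix⟩ := hrep t ht
      have hij : i ≠ j := by rintro rfl; exact absurd hix hjm.not_gt
      rw [mem_image]
      by_cases hia : i = a
      · exact ⟨b, by simp [hab.symm, hcon.2.symm], by rw [← hmab, ← hia, hi]⟩
      · exact ⟨i, by simp [hij, hia], hi⟩
    · intro i hij
      by_contra hcon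
      apply hsmall i j hij
      intro t ht
      obtain ⟨k, hk, hkx⟩ := hrep t ht
      rw [mem_image]
      refine ⟨k, ?_, hk⟩
      simp only [mem_erase, mem_univ, and_true]
      constructor
      · rintro rfl; exact absurd hkx hjm.not_gt
      · rintro rfl; exact hcon hkx
  have claim2 : ∀ j j', j' ≠ j → m j' = m j → ∃ x, x ∉ τ ∧ SDom u (insert x τ) ∧
      u j x < u j (m j) ∧ ∀ x', x' ∉ τ → SDom u (insert x' τ) → u j x' < u j (m j) → x' = x := by
    intro j j' hjj hmj
    obtain ⟨y0, hy0⟩ := hM j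
    have hMne : (univ.filter (fun y => ∀ i, i ≠ j → u i (m i) < u i y)).Nonempty := by
      refine ⟨y0, ?_⟩
      simp only [mem_filter, mem_univ, true_and]
      intro i hi
      obtain ⟨t, ht, h⟩ := hy0 i hi
      exact (hmin i t ht).trans_lt h
    obtain ⟨x, hxM, hxmax⟩ := exists_max_image _ (u j) hMne
    simp only [mem_filter, mem_univ, true_and] at hxM hxmax
    have hxτ : x ∉ τ := by
      intro hx
      obtain ⟨i, hi⟩ := hdom x
      have h1 : m i = x := hu i (le_antisymm (hmin i x hx) (hi _ (hmτ i)))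
      by_cases hij : i = j
      · have := hxM j' hjj
        rw [hmj, ← hij, h1] at this
        exact lt_irrefl _ this
      · have := hxM i hij
        rw [h1] at this
        exact lt_irrefl _ this
    have hxj : u j x < u j (m j) := by
      obtain ⟨i, hi⟩ := hdom x
      have h2 := hi _ (hmτ i)
      have hij : i = j := by
        by_contra hij
        exact absurd (hxM i hij) h2.not_gt
      subst hij
      refine lt_of_le_of_ne h2 fun h' => hxτ ?_
      rw [hu i h']; exact hmτ i
    refine ⟨x, hxτ, ?_, hxj, ?_⟩
    · intro y
      by_cases hy : ∀ i, i ≠ j → u i (m i) < u i y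
      · refine ⟨j, ?_⟩
        have h1 := hxmax y hy
        intro z hz
        rcases mem_insert.1 hz with rfl | hz
        · exact h1
        · exact h1.trans (hxj.le.trans (hmin j z hz))
      · push Not at hy
        obtain ⟨i, hij, hi⟩ := hy
        refine ⟨i, fun z hz => ?_⟩
        rcases mem_insert.1 hz with rfl | hz
        · exact hi.trans (hxM i hij).le
        · exact hi.trans (hmin i z hz)
    · intro x' hx' hd' hlt'
      obtain ⟨j1, -, h1, h2⟩ := claim1 x' hx' hd'
      have hj1 : j = j1 := by
        by_contra h
        exact absurd (h2 j h) hlt'.not_gt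
      subst hj1
      refine hu j (le_antisymm (hxmax x' h2) ?_)
      obtain ⟨i, hi⟩ := hd' x
      have hij : i = j := by
        by_contra hij
        exact absurd (hxM i hij) (hi _ (mem_insert_of_mem (hmτ i))).not_gt
      subst hij
      exact hi _ (mem_insert_self _ _)
  obtain ⟨xa, ha1, ha2, ha3, ha4⟩ := claim2 a b hab.symm hmab.symm
  obtain ⟨xb, hb1, hb2, hb3, hb4⟩ := claim2 b a hab hmab
  have hxab : xa ≠ xb := by
    rintro rfl
    obtain ⟨j, hj, h1, h2⟩ := claim1 xa ha1 ha2
    rcases hj with rfl | rfl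
    · exact absurd (h2 b hab.symm) hb3.not_gt
    · exact absurd (h2 a hab) ha3.not_gt
  rw [← card_pair hxab]
  congr 1
  ext x
  simp only [mem_filter, mem_univ, true_and, mem_insert, mem_singleton]
  constructor
  · rintro ⟨h1, h2⟩
    obtain ⟨j, hj, h3, -⟩ := claim1 x h1 h2
    rcases hj with rfl | rfl
    · exact Or.inl (ha4 x h1 h2 h3)
    · exact Or.inr (hb4 x h1 h2 h3)
  · rintro (rfl | rfl)
    · exact ⟨ha1, ha2⟩
    · exact ⟨hb1, hb2⟩

open Classical in
theorem scarf (u : I → S → L) (hu : ∀ i, Function.Injective (u i)) (e : I → S)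
    (he : Function.Injective e)
    (hemin : ∀ i s, u i (e i) ≤ u i s)
    (hemax : ∀ i j s, j ≠ i → s ∉ Set.range e → u i s < u i (e j))
    (s0 : S) (hs0 : s0 ∉ Set.range e) (i0 : I) (c : S → I) (hce : ∀ i, c (e i) = i) :
    ∃ R : Finset S, SDom u R ∧ R.image c = univ := by
  by_contra! hno
  set τ0 : Finset S := (univ.erase i0).image e with hτ0
  have hnpos : 0 < Fintype.card I := Fintype.card_pos_iff.2 ⟨i0⟩
  have hτ0card : τ0.card + 1 = Fintype.card I := by
    rw [hτ0, card_image_of_injective _ he, card_erase_of_mem (mem_univ _), card_univ]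
    omega
  -- count at the exceptional door
  have hexc : (univ.filter (fun x => x ∉ τ0 ∧ SDom u (insert x τ0))).card = 1 := by
    obtain ⟨x, hx, hxmax⟩ := exists_max_image (univ.filter (fun s => s ∉ Set.range e)) (u i0)
      ⟨s0, by simpa using hs0⟩
    simp only [mem_filter, mem_univ, true_and] at hx hxmax
    have hxe : ∀ i, ¬ (u i x ≤ u i (e i)) := fun i h =>
      hx ⟨i, (hu i (le_antisymm h (hemin i x))).symm⟩
    rw [card_eq_one]
    refine ⟨x, ?_⟩
    ext z
    simp only [mem_filter, mem_univ, true_and, mem_singleton]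
    constructor
    · rintro ⟨hz, hd⟩
      obtain ⟨i, hi⟩ := hd x
      have hii : i = i0 := by
        by_contra h
        exact hxe i (hi _ (mem_insert_of_mem (by rw [hτ0]; exact mem_image_of_mem _ (by simp [h]))))
      subst hii
      have h1 := hi z (mem_insert_self _ _)
      have hzr : z ∉ Set.range e := by
        rintro ⟨j, rfl⟩
        by_cases hj : j = i
        · subst hj; exact hxe j h1
        · exact hz (by rw [hτ0]; exact mem_image_of_mem _ (by simp [hj]))
      exact hu i (le_antisymm (hxmax z hzr) h1)
    · rintro rfl
      refine ⟨?_, ?_⟩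
      · intro h
        rw [hτ0, mem_image] at h
        obtain ⟨j, -, hj⟩ := h
        exact hx ⟨j, hj⟩
      · intro y
        by_cases hy : y ∈ Set.range e
        · obtain ⟨j, rfl⟩ := hy
          exact ⟨j, fun x _ => hemin j x⟩
        · refine ⟨i0, fun w hw => ?_⟩
          rcases mem_insert.1 hw with rfl | hw
          · exact hxmax y hy
          · rw [hτ0, mem_image] at hw
            obtain ⟨j, hj, rfl⟩ := hw
            exact (hemax i0 j y (mem_erase.1 hj).1 hy).le
  have hother : ∀ τ : Finset S, τ.card + 1 = Fintype.card I → τ.image c = univ.erase i0 →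
      τ ≠ τ0 → Even (univ.filter (fun x => x ∉ τ ∧ SDom u (insert x τ))).card := by
    intro τ hτ hcτ hne
    by_cases hdom : SDom u τ
    · have : (univ.filter (fun x => x ∉ τ ∧ SDom u (insert x τ))).card = 2 := by
        apply door_two u hu τ hτ _ hdom
        · intro a
          refine ⟨e a, fun i hia => ?_⟩
          by_contra! hcon
          have hsub : ∀ t ∈ τ, ∃ j, j ≠ i ∧ e j = t := by
            intro t ht
            have h1 := hcon t ht
            have h2 : t ∈ Set.range e := by
              by_contra h
              exact absurd (hemax i a t hia.symm h) h1.not_gt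
            obtain ⟨j, rfl⟩ := h2
            refine ⟨j, ?_, rfl⟩
            rintro rfl
            exact hia (he (hu j (le_antisymm (hemin j _) h1)))
          have hii : i = i0 := by
            by_contra h
            have : i ∈ τ.image c := by rw [hcτ]; simp [h]
            obtain ⟨t, ht, htc⟩ := mem_image.1 this
            obtain ⟨j, hj, rfl⟩ := hsub t ht
            rw [hce] at htc
            exact hj htc
          subst hii
          apply hne
          apply eq_of_subset_of_card_le
          · intro t ht
            obtain ⟨j, hj, rfl⟩ := hsub t ht
            rw [hτ0]; exact mem_image_of_mem _ (by simp [hj])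
          · omega
        · rw [nonempty_iff_ne_empty]
          rintro rfl
          rw [image_empty] at hcτ
          rw [← hcτ, image_empty] at hτ0
          exact hne hτ0.symm
      rw [this]; exact even_two
    · have : (univ.filter (fun x => x ∉ τ ∧ SDom u (insert x τ))) = ∅ := by
        rw [filter_eq_empty_iff]
        rintro x - ⟨-, h⟩
        apply hdom
        intro y
        obtain ⟨i, hi⟩ := h y
        exact ⟨i, fun z hz => hi z (mem_insert_of_mem hz)⟩
      rw [this]; simp
  -- double counting
  set doors : Finset (Finset S) :=
    univ.filter (fun τ => τ.card + 1 = Fintype.card I ∧ τ.image c = univ.erase i0) with hdoors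
  set rooms : Finset (Finset S) :=
    univ.filter (fun R => R.card = Fintype.card I ∧ SDom u R) with hrooms
  have hdc := sum_card_bipartiteAbove_eq_sum_card_bipartiteBelow (s := doors) (t := rooms)
    (fun τ R => τ ⊆ R)
  have hA : ∀ τ ∈ doors, (bipartiteAbove (fun τ R => τ ⊆ R) rooms τ).card =
      (univ.filter (fun x => x ∉ τ ∧ SDom u (insert x τ))).card := by
    intro τ hτ
    simp only [hdoors, mem_filter, mem_univ, true_and] at hτ
    symm
    apply card_bij (fun x _ => insert x τ)
    · intro x hx
      simp only [mem_filter, mem_univ, true_and] at hx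
      simp only [bipartiteAbove, hrooms, mem_filter, mem_univ, true_and]
      exact ⟨⟨by rw [card_insert_of_notMem hx.1, hτ.1], hx.2⟩, subset_insert _ _⟩
    · intro x hx y hy hxy
      simp only [mem_filter, mem_univ, true_and] at hx hy
      have : x ∈ insert y τ := hxy ▸ mem_insert_self x τ
      exact (mem_insert.1 this).resolve_right hx.1
    · intro R hR
      simp only [bipartiteAbove, hrooms, mem_filter, mem_univ, true_and] at hR
      obtain ⟨⟨h1, h2⟩, h3⟩ := hR
      have h4 : (R \ τ).card = 1 := by rw [card_sdiff_of_subset h3]; omega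
      obtain ⟨x, hx⟩ := card_eq_one.1 h4
      have hxm : x ∈ R \ τ := by rw [hx]; simp
      have hR : insert x τ = R := by
        rw [insert_eq, ← hx, sdiff_union_of_subset h3]
      refine ⟨x, ?_, hR⟩
      simp only [mem_filter, mem_univ, true_and]
      exact ⟨(mem_sdiff.1 hxm).2, hR ▸ h2⟩
  have hB : ∀ R ∈ rooms, Even (bipartiteBelow (fun τ R => τ ⊆ R) doors R).card := by
    intro R hR
    simp only [hrooms, mem_filter, mem_univ, true_and] at hR
    have := room_parity c i0 R hR.1 (hno R hR.2)
    convert this using 1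
    symm
    apply card_bij (fun x _ => R.erase x)
    · intro x hx
      simp only [mem_filter] at hx
      simp only [bipartiteBelow, hdoors, mem_filter, mem_univ, true_and]
      refine ⟨⟨?_, hx.2⟩, erase_subset _ _⟩
      rw [card_erase_of_mem hx.1]; omega
    · intro x hx y hy hxy
      simp only [mem_filter] at hx hy
      exact (erase_inj R hx.1).1 hxy
    · intro τ hτ
      simp only [bipartiteBelow, hdoors, mem_filter, mem_univ, true_and] at hτ
      obtain ⟨⟨h1, h2⟩, h3⟩ := hτ
      have h4 : (R \ τ).card = 1 := by rw [card_sdiff_of_subset h3]; omega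
      obtain ⟨x, hx⟩ := card_eq_one.1 h4
      have hxm : x ∈ R \ τ := by rw [hx]; simp
      have hR : R.erase x = τ := by
        rw [erase_eq, ← hx, Finset.sdiff_sdiff_eq_self h3]
      refine ⟨x, ?_, hR⟩
      simp only [mem_filter]
      exact ⟨(mem_sdiff.1 hxm).1, hR ▸ h2⟩
  have hEven : Even (∑ R ∈ rooms, (bipartiteBelow (fun τ R => τ ⊆ R) doors R).card) :=
    even_sum _ hB
  have hτ0d : τ0 ∈ doors := by
    simp only [hdoors, mem_filter, mem_univ, true_and]
    refine ⟨hτ0card, ?_⟩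
    rw [hτ0, image_image]
    have : c ∘ e = id := funext hce
    rw [this, image_id]
  rw [← hdc, sum_congr rfl hA, ← add_sum_erase _ _ hτ0d, hexc] at hEven
  have h2 : Even (∑ τ ∈ doors.erase τ0,
      (univ.filter (fun x => x ∉ τ ∧ SDom u (insert x τ))).card) := by
    apply even_sum
    intro τ hτ
    rw [mem_erase, hdoors, mem_filter] at hτ
    exact hother τ hτ.2.2.1 hτ.2.2.2 hτ.1
  rw [Nat.even_add] at hEven
  exact absurd (hEven.2 h2) (by decide)

end Scarf

section Grid
open Finset

open Classical in
theorem grid_lemma {I : Type*} [Fintype I] [Nonempty I] (k : ℕ) (P : I → (I → ℕ) → Prop)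
    (hP : ∀ x : I → ℕ, ∑ i, x i = k → ∃ i, P i x) :
    ∃ z : I → ℕ, ∑ i, z i = k ∧ ∀ i, z i ≤ Fintype.card I ∨
      ∃ w : I → ℕ, ∑ i, w i = k ∧ (∀ j, z j ≤ w j + Fintype.card I ∧
        w j ≤ z j + Fintype.card I) ∧ P i w := by
  let T := {x : I → ℕ // x ∈ piAntidiag (univ : Finset I) k}
  have hT : ∀ x : T, ∑ i, x.1 i = k := fun x => (mem_piAntidiag.1 x.2).1
  have hmk : ∀ x : I → ℕ, ∑ i, x i = k → x ∈ piAntidiag (univ : Finset I) k := fun x hx =>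
    mem_piAntidiag.2 ⟨hx, fun i _ => mem_univ i⟩
  have hle : ∀ (x : T) i, x.1 i ≤ k := fun x i => by
    exact (single_le_sum (f := x.1) (fun _ _ => Nat.zero_le _) (mem_univ i)).trans (hT x).le
  choose c0 hc0 using fun x : T => hP x.1 (hT x)
  let c : T ⊕ I → I := Sum.elim c0 id
  let u : I → T ⊕ I → ℤ ×ₗ ℕ := fun i => Sum.elim
    (fun x => toLex ((x.1 i : ℤ), (Fintype.equivFin T x : ℕ)))
    (fun j => if j = i then toLex (-1, 0) else toLex ((k : ℤ) + 1, (Fintype.equivFin I j : ℕ)))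
  have hui : ∀ i, Function.Injective (u i) := by
    intro i a b hab
    rcases a with x | j <;> rcases b with y | l
    · have h : ((x.1 i : ℤ), (Fintype.equivFin T x : ℕ)) = ((y.1 i : ℤ), (Fintype.equivFin T y : ℕ)) :=
        toLex.injective hab
      have h2 := (Prod.mk.inj h).2
      rw [(Fintype.equivFin T).injective (Fin.ext h2)]
    · exfalso
      have h1 := hle x i
      simp only [u, Sum.elim_inl, Sum.elim_inr] at hab
      split_ifs at hab
      · have := (Prod.mk.inj (toLex.injective hab)).1; omega
      · have := (Prod.mk.inj (toLex.injective hab)).1; omega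
    · exfalso
      have h1 := hle y i
      simp only [u, Sum.elim_inl, Sum.elim_inr] at hab
      split_ifs at hab
      · have := (Prod.mk.inj (toLex.injective hab)).1; omega
      · have := (Prod.mk.inj (toLex.injective hab)).1; omega
    · simp only [u, Sum.elim_inr] at hab
      split_ifs at hab with h1 h2 h2
      · rw [h1, h2]
      · have := (Prod.mk.inj (toLex.injective hab)).1; omega
      · have := (Prod.mk.inj (toLex.injective hab)).1; omega
      · have := (Prod.mk.inj (toLex.injective hab)).2
        rw [(Fintype.equivFin I).injective (Fin.ext this)]
  obtain ⟨i0⟩ := ‹Nonempty I›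
  have hs : ∑ i, (Pi.single i0 k : I → ℕ) i = k := by simp
  let t0 : T := ⟨Pi.single i0 k, hmk _ hs⟩
  obtain ⟨R, hdom, hRc⟩ := scarf u hui (Sum.inr : I → T ⊕ I) Sum.inr_injective
    (by
      intro i s
      rcases s with x | j
      · simp only [u, Sum.elim_inl, Sum.elim_inr, if_true]
        rw [Prod.Lex.toLex_le_toLex]; left; simp only; omega
      · simp only [u, Sum.elim_inr, if_true]
        split_ifs
        · exact le_rfl
        · rw [Prod.Lex.toLex_le_toLex]; left; simp only; omega)
    (by
      intro i j s hji hs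
      rcases s with x | l
      · simp only [u, Sum.elim_inl, Sum.elim_inr, if_neg hji]
        have := hle x i
        rw [Prod.Lex.toLex_lt_toLex]; left; simp only; omega
      · exact absurd ⟨l, rfl⟩ hs)
    (Sum.inl t0) (by simp) i0 c (fun i => rfl)
  let C : Finset I := univ.filter (fun i => ∃ x : T, Sum.inl x ∈ R ∧ c0 x = i)
  have hC : ∀ i, i ∈ C ↔ ∃ x : T, Sum.inl x ∈ R ∧ c0 x = i := fun i => by simp [C]
  have hnC : ∀ i, i ∉ C → Sum.inr i ∈ R := by
    intro i hi
    have : i ∈ R.image c := by rw [hRc]; exact mem_univ i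
    obtain ⟨s, hs, hsc⟩ := mem_image.1 this
    rcases s with x | j
    · exact absurd ((hC i).2 ⟨x, hs, hsc⟩) hi
    · have : j = i := hsc
      exact this ▸ hs
  have hD : ∀ y : T, ∃ i ∈ C, ∀ x : T, Sum.inl x ∈ R → y.1 i ≤ x.1 i := by
    intro y
    obtain ⟨i, hi⟩ := hdom (Sum.inl y)
    refine ⟨i, ?_, ?_⟩
    · by_contra h
      have h1 := hi _ (hnC i h)
      simp only [u, Sum.elim_inl, Sum.elim_inr, if_true] at h1
      rw [Prod.Lex.toLex_le_toLex] at h1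
      simp only at h1
      omega
    · intro x hx
      have h1 := hi _ hx
      simp only [u, Sum.elim_inl] at h1
      rw [Prod.Lex.toLex_le_toLex] at h1
      simp only at h1
      omega
  obtain ⟨i1, hi1, -⟩ := hD t0
  obtain ⟨z, hzR, -⟩ := (hC i1).1 hi1
  let Rt : Finset T := univ.filter (fun x => Sum.inl x ∈ R)
  have hRt : ∀ x, x ∈ Rt ↔ Sum.inl x ∈ R := fun x => by simp [Rt]
  have hmin : ∀ i, ∃ x ∈ Rt, ∀ x' ∈ Rt, x.1 i ≤ x'.1 i := fun i =>
    exists_min_image Rt (fun x => x.1 i) ⟨z, (hRt z).2 hzR⟩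
  choose p hpR hpmin using hmin
  let M : I → ℕ := fun i => if i ∈ C then (p i).1 i else 0
  have hMle : ∀ x : T, Sum.inl x ∈ R → ∀ i, M i ≤ x.1 i := by
    intro x hx i
    simp only [M]
    split_ifs
    · exact hpmin i x ((hRt x).2 hx)
    · exact Nat.zero_le _
  have hsum : k ≤ ∑ i, M i + Fintype.card I := by
    by_contra! hcon
    let b : I → ℕ := fun i => M i + 1
    have hb : ∑ i, b i < k := by
      simp only [b, sum_add_distrib, sum_const, card_univ, smul_eq_mul, mul_one]
      exact hcon
    let y : I → ℕ := fun i => b i + (Pi.single i1 (k - ∑ i, b i) : I → ℕ) i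
    have hy : ∑ i, y i = k := by
      simp only [y]
      rw [sum_add_distrib, sum_pi_single', if_pos (mem_univ _)]
      omega
    obtain ⟨i, hi, hyi⟩ := hD ⟨y, hmk y hy⟩
    have h1 := hyi (p i) ((hRt _).1 (hpR i))
    simp only [y, b, M, if_pos hi] at h1
    omega
  have hub : ∀ x : T, Sum.inl x ∈ R → ∀ i, x.1 i ≤ M i + Fintype.card I := by
    intro x hx i
    have h1 : ∑ j, (x.1 j - M j) + ∑ j, M j = k := by
      rw [← sum_add_distrib]
      exact (sum_congr rfl fun j _ => Nat.sub_add_cancel (hMle x hx j)).trans (hT x)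
    have h2 : x.1 i - M i ≤ ∑ j, (x.1 j - M j) :=
      single_le_sum (f := fun j => x.1 j - M j) (fun _ _ => Nat.zero_le _) (mem_univ i)
    omega
  refine ⟨z.1, hT z, fun i => ?_⟩
  by_cases hi : i ∈ C
  · right
    obtain ⟨w, hwR, hwc⟩ := (hC i).1 hi
    refine ⟨w.1, hT w, fun j => ?_, hwc ▸ hc0 w⟩
    have h1 := hub z hzR j
    have h2 := hub w hwR j
    have h3 := hMle z hzR j
    have h4 := hMle w hwR j
    omega
  · left
    have h1 := hub z hzR i
    simpa [M, hi] using h1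

end Grid

theorem fixed_of_approx {X : Type*} [MetricSpace X] {K : Set X} (hK : IsCompact K) {f : X → X}
    (hf : ContinuousOn f K) (h : ∀ ε > 0, ∃ z ∈ K, dist (f z) z ≤ ε) : ∃ z ∈ K, f z = z := by
  obtain ⟨z0, hz0, -⟩ := h 1 one_pos
  obtain ⟨z, hz, hmin⟩ := hK.exists_isMinOn ⟨z0, hz0⟩ 
    (f := fun z => dist (f z) z) (continuous_dist.comp_continuousOn (hf.prodMk continuousOn_id))
  refine ⟨z, hz, ?_⟩
  by_contra hne
  have hpos : 0 < dist (f z) z := dist_pos.2 hne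
  obtain ⟨w, hw, hwd⟩ := h (dist (f z) z / 2) (by positivity)
  have h1 : dist (f z) z ≤ dist (f w) w := hmin hw
  linarith

theorem brouwer_simplex {I : Type*} [Fintype I] [Nonempty I] (f : (I → ℝ) → (I → ℝ))
    (hmaps : Set.MapsTo f (stdSimplex ℝ I) (stdSimplex ℝ I))
    (hf : ContinuousOn f (stdSimplex ℝ I)) : ∃ z ∈ stdSimplex ℝ I, f z = z := by
  have hK := isCompact_stdSimplex ℝ I
  apply fixed_of_approx hK hf
  intro ε' hε'
  set n : ℝ := (Fintype.card I : ℝ) with hn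
  have hnpos : 0 < n := by rw [hn]; exact_mod_cast Fintype.card_pos
  set ε := ε' / n with hεdef
  have hε : 0 < ε := by positivity
  have huc := hK.uniformContinuousOn_of_continuous hf
  rw [Metric.uniformContinuousOn_iff] at huc
  obtain ⟨δ, hδ, huc⟩ := huc (ε / 2) (by positivity)
  set η := min (δ / 2) (ε / 2) with hη
  have hηpos : 0 < η := by positivity
  obtain ⟨k, hk⟩ := exists_nat_gt (n / η)
  have hkpos : (0 : ℝ) < k := lt_of_le_of_lt (by positivity) hk
  have hnk : n / k ≤ η := by
    rw [div_lt_iff₀ hηpos] at hk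
    rw [div_le_iff₀ hkpos]; linarith
  let g : (I → ℕ) → (I → ℝ) := fun x i => (x i : ℝ) / k
  have hg : ∀ x : I → ℕ, ∑ i, x i = k → g x ∈ stdSimplex ℝ I := by
    intro x hx
    refine ⟨fun i => by positivity, ?_⟩
    simp only [g]
    rw [← Finset.sum_div, ← Nat.cast_sum, hx, div_self hkpos.ne']
  obtain ⟨z, hz, hzi⟩ := grid_lemma k (fun i x => g x i ≤ f (g x) i) (by
    intro x hx
    by_contra! hcon
    have h1 : ∑ i, f (g x) i < ∑ i, g x i :=
      Finset.sum_lt_sum_of_nonempty Finset.univ_nonempty fun i _ => hcon i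
    rw [(hmaps (hg x hx)).2, (hg x hx).2] at h1
    exact lt_irrefl _ h1)
  have hzΔ := hg z hz
  have hfz := hmaps hzΔ
  refine ⟨g z, hzΔ, ?_⟩
  have key : ∀ i, g z i - f (g z) i ≤ ε := by
    intro i
    rcases hzi i with h | ⟨w, hw, hclose, hwi⟩
    · have h1 : g z i ≤ n / k := by
        simp only [g]
        gcongr
        rw [hn]; exact_mod_cast h
      have h2 := hfz.1 i
      have h3 : η ≤ ε / 2 := min_le_right _ _
      linarith
    · have hd : ∀ j, dist (g z j) (g w j) ≤ n / k := by
        intro j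
        obtain ⟨h1, h2⟩ := hclose j
        have h1' : (z j : ℝ) ≤ w j + n := by rw [hn]; exact_mod_cast h1
        have h2' : (w j : ℝ) ≤ z j + n := by rw [hn]; exact_mod_cast h2
        rw [Real.dist_eq]
        simp only [g]
        rw [← sub_div, abs_div, abs_of_pos hkpos]
        gcongr
        rw [abs_le]; constructor <;> linarith
      have hdd : dist (g z) (g w) ≤ n / k := (dist_pi_le_iff (by positivity)).2 hd
      have h3 : η ≤ ε / 2 := min_le_right _ _
      have h4 : η ≤ δ / 2 := min_le_left _ _
      have h5 := huc _ hzΔ _ (hg w hw) (by linarith)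
      have h6 := (dist_le_pi_dist (f (g z)) (f (g w)) i).trans h5.le
      have h7 := hd i
      rw [Real.dist_eq, abs_le] at h6 h7
      linarith [h6.1, h6.2, h7.1, h7.2]
  have hnε : n * ε = ε' := by rw [hεdef]; field_simp
  have hn1 : 1 ≤ n := by rw [hn]; exact_mod_cast Fintype.card_pos (α := I)
  rw [dist_pi_le_iff hε'.le]
  intro i
  rw [Real.dist_eq, abs_le]
  constructor
  · have := key i
    nlinarith
  · classical
    have h1 : ∑ j, (g z j - f (g z) j) = 0 := by
      rw [Finset.sum_sub_distrib, hzΔ.2, hfz.2, sub_self]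
    rw [← Finset.add_sum_erase _ _ (Finset.mem_univ i)] at h1
    have h2 : ∑ j ∈ Finset.univ.erase i, (g z j - f (g z) j) ≤
        ∑ j ∈ Finset.univ.erase i, ε := Finset.sum_le_sum fun j _ => key j
    have h3 : ∑ j ∈ Finset.univ.erase i, ε ≤ ∑ j : I, ε :=
      Finset.sum_le_sum_of_subset_of_nonneg (Finset.subset_univ _) fun _ _ _ => hε.le
    have h4 : ∑ j : I, ε = ε' := by
      rw [Finset.sum_const, Finset.card_univ, nsmul_eq_mul, ← hn, hnε]
    linarith

theorem schauder_fixed_point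
    {X : Type*} [NormedAddCommGroup X] [NormedSpace ℝ X] [CompleteSpace X]
    (A : Set X) (hA : A.Nonempty) (hAconv : Convex ℝ A) (hAcomp : IsCompact A)
    (T : X → X) (hTmaps : Set.MapsTo T A A) (hTcont : ContinuousOn T A) :
    ∃ x ∈ A, T x = x := by
  apply fixed_of_approx hAcomp hTcont
  intro ε hε
  obtain ⟨t, htA, htfin, hcov⟩ := hAcomp.finite_cover_balls hε
  have : Fintype t := htfin.fintype
  have hcov' : ∀ x ∈ A, ∃ p : t, dist x p < ε := by
    intro x hx
    obtain ⟨p, hp, h⟩ := Set.mem_iUnion₂.1 (hcov hx)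
    exact ⟨⟨p, hp⟩, h⟩
  obtain ⟨a, ha⟩ := hA
  have : Nonempty t := ⟨(hcov' a ha).choose⟩
  let φ : X → t → ℝ := fun x p => max 0 (ε - dist x p)
  have hφ0 : ∀ x p, 0 ≤ φ x p := fun x p => le_max_left _ _
  have hφpos : ∀ x ∈ A, 0 < ∑ p, φ x p := by
    intro x hx
    obtain ⟨p, hp⟩ := hcov' x hx
    refine Finset.sum_pos' (fun p _ => hφ0 x p) ⟨p, Finset.mem_univ _, ?_⟩
    exact lt_max_of_lt_right (by linarith)
  let g : (t → ℝ) → X := fun z => ∑ p, z p • (p : X)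
  have hg : Continuous g := by fun_prop
  have hgA : Set.MapsTo g (stdSimplex ℝ t) A := by
    intro z hz
    exact hAconv.sum_mem (fun p _ => hz.1 p) hz.2 (fun p _ => htA p.2)
  have hTg : ContinuousOn (fun z => T (g z)) (stdSimplex ℝ t) := hTcont.comp hg.continuousOn hgA
  have hTgA : ∀ z ∈ stdSimplex ℝ t, T (g z) ∈ A := fun z hz => hTmaps (hgA hz)
  have hφc : ∀ p, ContinuousOn (fun z => φ (T (g z)) p) (stdSimplex ℝ t) := by
    intro p
    have hc : Continuous (fun x => φ x p) := by fun_prop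
    exact hc.comp_continuousOn hTg
  obtain ⟨z, hz, hfix⟩ := brouwer_simplex
    (fun z p => φ (T (g z)) p / ∑ q, φ (T (g z)) q)
    (by
      intro z hz
      refine ⟨fun p => div_nonneg (hφ0 _ _) (hφpos _ (hTgA z hz)).le, ?_⟩
      rw [← Finset.sum_div, div_self (hφpos _ (hTgA z hz)).ne'])
    (by
      rw [continuousOn_pi]
      intro p
      exact (hφc p).div (continuousOn_finsetSum _ fun q _ => hφc q)
        fun z hz => (hφpos _ (hTgA z hz)).ne')
  refine ⟨g z, hgA hz, ?_⟩
  have h1 : T (g z) - g z = ∑ p, z p • (T (g z) - (p : X)) := by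
    simp only [smul_sub, Finset.sum_sub_distrib, ← Finset.sum_smul, hz.2, one_smul, g]
  rw [dist_eq_norm, h1]
  calc ‖∑ p, z p • (T (g z) - (p : X))‖ ≤ ∑ p, ‖z p • (T (g z) - (p : X))‖ := norm_sum_le _ _
    _ ≤ ∑ p, z p * ε := by
      refine Finset.sum_le_sum fun p _ => ?_
      rw [norm_smul, Real.norm_of_nonneg (hz.1 p)]
      by_cases hd : dist (T (g z)) p < ε
      · rw [← dist_eq_norm]
        exact mul_le_mul_of_nonneg_left hd.le (hz.1 p)
      · have h2 : φ (T (g z)) p = 0 := max_eq_left (by linarith)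
        have h3 : z p = 0 := by
          have := congrFun hfix p
          simp only [h2, zero_div] at this
          exact this.symm
        simp [h3]
    _ = ε := by rw [← Finset.sum_mul, hz.2, one_mul]
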